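/- There is no regular pentagon all of whose vertices have rational coordinates; a fortiori, no regular pentagon has all its vertices in ℤ^d for any d. Precisely: for every d ≥ 1 there do not exist a real λ > 0 and a map f : {0,1,2,3,4} → ℚ^d such that ‖f(j) − f(k)‖ = λ · ‖v_j − v_k‖ for all j, k, where v_k = (cos(2πk/5), sin(2πk/5)) ∈ ℝ² are the vertices of the standard regular pentagon. -/

import Mathlib

/-- The vertices of the standard regular pentagon in the Euclidean plane. -/
noncomputable def pentagonVertex (k : Fin 5) : EuclideanSpace ℝ (Fin 2) :=
  (EuclideanSpace.equiv (Fin 2) ℝ).symm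
    ![Real.cos (2 * Real.pi * (k : ℕ) / 5), Real.sin (2 * Real.pi * (k : ℕ) / 5)]

theorem dist_sq_pentagonVertex_zero (k : Fin 5) :
    dist (pentagonVertex 0) (pentagonVertex k) ^ 2 =
      2 - 2 * Real.cos (2 * Real.pi * (k : ℕ) / 5) := by
  rw [EuclideanSpace.dist_eq, Real.sq_sqrt (by positivity)]
  simp only [pentagonVertex, Fin.sum_univ_two, Real.dist_eq, sq_abs]
  simp
  nlinarith [Real.sin_sq_add_cos_sq (2 * Real.pi * (k : ℕ) / 5)]

theorem dist_sq_pentagonVertex_zero_one :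
    dist (pentagonVertex 0) (pentagonVertex 1) ^ 2 = (5 - √5) / 2 := by
  rw [dist_sq_pentagonVertex_zero,
    show 2 * Real.pi * ((1 : Fin 5) : ℕ) / 5 = 2 * (Real.pi / 5) by simp; ring,
    Real.cos_two_mul, Real.cos_pi_div_five]
  linarith [Real.sq_sqrt (show (0 : ℝ) ≤ 5 by norm_num)]

theorem dist_sq_pentagonVertex_zero_two :
    dist (pentagonVertex 0) (pentagonVertex 2) ^ 2 = (5 + √5) / 2 := by
  rw [dist_sq_pentagonVertex_zero,
    show 2 * Real.pi * ((2 : Fin 5) : ℕ) / 5 = Real.pi - Real.pi / 5 by simp; ring,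
    Real.cos_pi_sub, Real.cos_pi_div_five]
  ring

theorem exists_rat_dist_sq {ι : Type*} [Fintype ι] (x y : ι → ℚ) :
    ∃ q : ℚ, dist ((EuclideanSpace.equiv ι ℝ).symm fun i => (x i : ℝ))
      ((EuclideanSpace.equiv ι ℝ).symm fun i => (y i : ℝ)) ^ 2 = q := by
  refine ⟨∑ i, (x i - y i) ^ 2, ?_⟩
  rw [EuclideanSpace.dist_eq, Real.sq_sqrt (by positivity)]
  simp [Real.dist_eq, sq_abs]

/-- There is no regular pentagon all of whose vertices have rational coordinates: no
similarity copy (with ratio `λ > 0`) of the standard regular pentagon has all five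
vertices in `ℚ^d`. -/
theorem no_rational_regular_pentagon (d : ℕ) (hd : 1 ≤ d) :
    ¬ ∃ (lam : ℝ) (f : Fin 5 → Fin d → ℚ), 0 < lam ∧
        ∀ j k : Fin 5,
          dist ((EuclideanSpace.equiv (Fin d) ℝ).symm fun i => ((f j i : ℚ) : ℝ))
               ((EuclideanSpace.equiv (Fin d) ℝ).symm fun i => ((f k i : ℚ) : ℝ))
            = lam * dist (pentagonVertex j) (pentagonVertex k) := by
  rintro ⟨lam, f, hlam, h⟩
  obtain ⟨q, hq⟩ := exists_rat_dist_sq (f 0) (f 1)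
  obtain ⟨r, hr⟩ := exists_rat_dist_sq (f 0) (f 2)
  rw [h, mul_pow, dist_sq_pentagonVertex_zero_one] at hq
  rw [h, mul_pow, dist_sq_pentagonVertex_zero_two] at hr
  have hpos : (0 : ℝ) < q + r := by
    rw [← hq, ← hr]
    linarith [pow_pos hlam 2]
  have hsqrt : √5 = ((5 * (r - q) / (q + r) : ℚ) : ℝ) := by
    push_cast
    rw [eq_div_iff hpos.ne', ← hq, ← hr]
    ring
  have hirr : Irrational √5 := by
    simpa using Nat.Prime.irrational_sqrt (show Nat.Prime 5 by norm_num)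
  exact hirr ⟨_, hsqrt.symm⟩
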